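/- Let f_θ be a two-layer ReLU network fit to training data (x_1,y_1),…,(x_n,y_n) with all x_i in the closed ball B_R^d, let g be the data-dependent weight determined by x_1,…,x_n, and let η > 0. If L is twice differentiable at θ and λ_max(∇²_θ L(θ)) ≤ 2/η (i.e. f_θ ∈ F_stable(η)), then |f_θ|_{V_g} ≤ 1/η − 1/2 + (R+1)√(2 L(θ)). -/

import Mathlib

open MeasureTheory Real Filter ProbabilityTheory
open scoped ENNReal Classical BigOperators

noncomputable section

abbrev Euc (d : ℕ) : Type := EuclideanSpace ℝ (Fin d)

def relu (t : ℝ) : ℝ := max t 0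

abbrev ParamIx (d K : ℕ) : Type := (Fin K × Fin d) ⊕ (Fin K ⊕ (Fin K ⊕ Unit))

abbrev Params (d K : ℕ) : Type := EuclideanSpace ℝ (ParamIx d K)

/-- input-layer weight `w_k j` -/
def wP {d K : ℕ} (θ : Params d K) (k : Fin K) (j : Fin d) : ℝ := θ (Sum.inl (k, j))
/-- input-layer bias `b_k` -/
def bP {d K : ℕ} (θ : Params d K) (k : Fin K) : ℝ := θ (Sum.inr (Sum.inl k))
/-- output-layer weight `v_k` -/
def vP {d K : ℕ} (θ : Params d K) (k : Fin K) : ℝ := θ (Sum.inr (Sum.inr (Sum.inl k)))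
/-- output bias `β` -/
def betaP {d K : ℕ} (θ : Params d K) : ℝ := θ (Sum.inr (Sum.inr (Sum.inr ())))

/-- two-layer ReLU network `f_θ(x) = Σ_k v_k relu(w_kᵀ x − b_k) + β` -/
def netFun {d K : ℕ} (θ : Params d K) (x : Euc d) : ℝ :=
  (∑ k, vP θ k * relu ((∑ j, wP θ k j * x j) - bP θ k)) + betaP θ

/-- empirical squared loss -/
def empLoss {d K : ℕ} (n : ℕ) (x : Fin n → Euc d) (y : Fin n → ℝ) (θ : Params d K) : ℝ :=
  (1 / (2 * (n : ℝ))) * ∑ i, (y i - netFun θ (x i)) ^ 2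

/-- Hessian quadratic form `vᵀ ∇²L(θ) v` -/
def hessQF {E : Type*} [NormedAddCommGroup E] [NormedSpace ℝ E] (L : E → ℝ) (θ v : E) : ℝ :=
  iteratedFDeriv ℝ 2 L θ ![v, v]

/-- largest eigenvalue of the (symmetric) Hessian of `L` at `θ` -/
def lambdaMax {E : Type*} [NormedAddCommGroup E] [NormedSpace ℝ E] (L : E → ℝ) (θ : E) : ℝ :=
  ⨆ v : {v : E // ‖v‖ = 1}, hessQF L θ v.1

/-- weighted variation seminorm -/
def VgSeminorm (d : ℕ) (R : ℝ) (g : Euc d × ℝ → ℝ) (f : Euc d → ℝ) : ℝ≥0∞ :=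
  sInf { m : ℝ≥0∞ |
    ∃ (ν : MeasureTheory.SignedMeasure (Euc d × ℝ)) (c : Euc d) (c₀ : ℝ),
      ν.totalVariation ((Metric.sphere (0 : Euc d) 1 ×ˢ Set.Icc (-R) R)ᶜ) = 0 ∧
      (∀ x ∈ Metric.closedBall (0 : Euc d) R,
        f x = (∫ p : Euc d × ℝ, relu ((∑ j, p.1 j * x j) - p.2)
                  ∂ν.toJordanDecomposition.posPart)
              - (∫ p : Euc d × ℝ, relu ((∑ j, p.1 j * x j) - p.2)
                  ∂ν.toJordanDecomposition.negPart)
              + (∑ j, c j * x j) + c₀) ∧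
      m = ∫⁻ p, ENNReal.ofReal (g p) ∂ν.totalVariation }

def gTilde {d : ℕ} (n : ℕ) (x : Fin n → Euc d) (u : Euc d) (t : ℝ) : ℝ :=
  (((Finset.univ.filter fun i => t < ∑ j, u j * x i j).card : ℝ) / (n : ℝ)) ^ 2 *
    ((∑ i ∈ Finset.univ.filter fun i => t < ∑ j, u j * x i j, ((∑ j, u j * x i j) - t)) /
      ((Finset.univ.filter fun i => t < ∑ j, u j * x i j).card : ℝ)) *
    Real.sqrt (1 + ‖(((Finset.univ.filter fun i => t < ∑ j, u j * x i j).card : ℝ))⁻¹ •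
      ∑ i ∈ Finset.univ.filter fun i => t < ∑ j, u j * x i j, x i‖ ^ 2)

def gData {d : ℕ} (n : ℕ) (x : Fin n → Euc d) : Euc d × ℝ → ℝ :=
  fun p => min (gTilde n x p.1 p.2) (gTilde n x (-p.1) (-p.2))

def gPow (d : ℕ) : Euc d × ℝ → ℝ :=
  fun p => if |p.2| ≤ 1 then (1 - |p.2|) ^ (d + 2) else 0

def uniformBall (d : ℕ) : Measure (Euc d) :=
  (volume (Metric.closedBall (0 : Euc d) 1))⁻¹ • volume.restrict (Metric.closedBall 0 1)

instance (d : ℕ) : IsProbabilityMeasure (uniformBall d) := by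
  constructor
  rw [uniformBall, Measure.smul_apply, Measure.restrict_apply MeasurableSet.univ,
    Set.univ_inter, smul_eq_mul, ENNReal.inv_mul_cancel]
  · exact (Metric.measure_closedBall_pos volume (0 : Euc d) one_pos).ne'
  · exact (isCompact_closedBall _ _).measure_lt_top.ne

/-- set of stable solutions for the dataset `(x, y)` -/
def FStable (d : ℕ) (η : ℝ) {n : ℕ} (x : Fin n → Euc d) (y : Fin n → ℝ) (f : Euc d → ℝ) : Prop :=
  ∃ (K : ℕ) (θ : Params d K),
    (∀ z, f z = netFun θ z) ∧
    ContDiffAt ℝ 2 (empLoss n x y) θ ∧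
    lambdaMax (empLoss n x y) θ ≤ 2 / η

/-- membership in the (unweighted) variation ball `V_C(B_1^d)` -/
def memVC (d : ℕ) (C : ℝ) (f : Euc d → ℝ) : Prop :=
  ∃ (ν : MeasureTheory.SignedMeasure (Euc d × ℝ)) (c : Euc d) (b : ℝ),
    ν.totalVariation ((Metric.sphere (0 : Euc d) 1 ×ˢ Set.Icc (-1 : ℝ) 1)ᶜ) = 0 ∧
    ν.totalVariation Set.univ ≤ ENNReal.ofReal C ∧
    ∀ x ∈ Metric.closedBall (0 : Euc d) 1,
      f x = (∫ p : Euc d × ℝ, relu ((∑ j, p.1 j * x j) - p.2)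
                ∂ν.toJordanDecomposition.posPart)
            - (∫ p : Euc d × ℝ, relu ((∑ j, p.1 j * x j) - p.2)
                ∂ν.toJordanDecomposition.negPart)
            + (∑ j, c j * x j) + b


theorem hessQF_le {E : Type*} [NormedAddCommGroup E] [NormedSpace ℝ E] (L : E → ℝ) (θ G : E) :
    hessQF L θ G ≤ lambdaMax L θ * ‖G‖ ^ 2 := by
  by_cases hG : G = 0
  · subst hG
    have : hessQF L θ 0 = 0 := by
      unfold hessQF
      rw [iteratedFDeriv_two_apply]; simp
    simp [this]
  have hpos : 0 < ‖G‖ := norm_pos_iff.mpr hG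
  set u : E := ‖G‖⁻¹ • G with hu
  have hun : ‖u‖ = 1 := by
    rw [hu, norm_smul, norm_inv, norm_norm]; field_simp
  have hbdd : BddAbove (Set.range fun v : {v : E // ‖v‖ = 1} => hessQF L θ v.1) := by
    refine ⟨‖iteratedFDeriv ℝ 2 L θ‖, ?_⟩
    rintro _ ⟨⟨v, hv⟩, rfl⟩
    have h := ContinuousMultilinearMap.le_opNorm (iteratedFDeriv ℝ 2 L θ) ![v, v]
    simp [Fin.prod_univ_two, hv] at h
    exact (le_abs_self _).trans h
  have h1 : hessQF L θ u ≤ lambdaMax L θ := le_ciSup hbdd ⟨u, hun⟩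
  have h2 : hessQF L θ G = hessQF L θ u * ‖G‖ ^ 2 := by
    have hGu : G = ‖G‖ • u := by rw [hu, smul_smul, mul_inv_cancel₀ hpos.ne', one_smul]
    have e : ∀ (c : ℝ) (w : E), hessQF L θ (c • w) = hessQF L θ w * c ^ 2 := by
      intro c w
      unfold hessQF
      rw [iteratedFDeriv_two_apply, iteratedFDeriv_two_apply]; simp; ring
    conv_lhs => rw [hGu]
    exact e _ _
  rw [h2]
  gcongr

theorem hessQF_line {E : Type*} [NormedAddCommGroup E] [NormedSpace ℝ E] (L : E → ℝ) (θ G : E)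
    (h : ContDiffAt ℝ 2 L θ) (c0 c1 c2 c3 c4 : ℝ)
    (hp : ∀ᶠ s : ℝ in nhds 0, L (θ + s • G) = c0 + c1 * s + c2 * s ^ 2 + c3 * s ^ 3 + c4 * s ^ 4) :
    hessQF L θ G = 2 * c2 := by
  have hline : ∀ s : ℝ, HasDerivAt (fun s : ℝ => θ + s • G) G s := by
    intro s
    have := ((hasDerivAt_id s).smul_const G).const_add θ
    simpa using this
  have hcont : Tendsto (fun s : ℝ => θ + s • G) (nhds 0) (nhds θ) := by
    have := (hline 0).continuousAt.tendsto
    simpa using this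
  have hev := hcont.eventually (h.eventually (by simp))
  have hd1 : ∀ᶠ s : ℝ in nhds 0, fderiv ℝ L (θ + s • G) G
      = c1 + 2 * c2 * s + 3 * c3 * s ^ 2 + 4 * c4 * s ^ 3 := by
    filter_upwards [hev, hp.eventually_nhds] with s hs hps
    have h1 : HasDerivAt (fun s : ℝ => L (θ + s • G)) (fderiv ℝ L (θ + s • G) G) s :=
      (hs.differentiableAt (by simp)).hasFDerivAt.comp_hasDerivAt s (hline s)
    have h2 : HasDerivAt (fun s : ℝ => c0 + c1 * s + c2 * s ^ 2 + c3 * s ^ 3 + c4 * s ^ 4)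
        (c1 + 2 * c2 * s + 3 * c3 * s ^ 2 + 4 * c4 * s ^ 3) s := by
      have := (((((hasDerivAt_id s).const_mul c1).const_add c0).add
        (((hasDerivAt_id s).pow 2).const_mul c2)).add
        (((hasDerivAt_id s).pow 3).const_mul c3)).add (((hasDerivAt_id s).pow 4).const_mul c4)
      refine this.congr_deriv ?_
      simp; ring
    exact h1.unique (h2.congr_of_eventuallyEq hps)
  have hf : HasFDerivAt (fderiv ℝ L) (fderiv ℝ (fderiv ℝ L) θ) (θ + (0:ℝ) • G) := by
    rw [zero_smul, add_zero]
    exact ((h.fderiv_right (m := 1) (by norm_num)).differentiableAt (by simp)).hasFDerivAt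
  have h1 : HasDerivAt (fun s : ℝ => fderiv ℝ L (θ + s • G) G)
      (fderiv ℝ (fderiv ℝ L) θ G G) 0 := by
    have := hf.comp_hasDerivAt (0:ℝ) (hline 0)
    have := this.clm_apply (hasDerivAt_const (0:ℝ) G)
    simpa using this
  have h2 : HasDerivAt (fun s : ℝ => c1 + 2 * c2 * s + 3 * c3 * s ^ 2 + 4 * c4 * s ^ 3)
        (2 * c2) 0 := by
    have := (((((hasDerivAt_id (0:ℝ)).const_mul (2 * c2)).const_add c1).add
        (((hasDerivAt_id (0:ℝ)).pow 2).const_mul (3 * c3))).add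
        (((hasDerivAt_id (0:ℝ)).pow 3).const_mul (4 * c4)))
    refine this.congr_deriv ?_
    simp
  unfold hessQF
  rw [iteratedFDeriv_two_apply]
  exact h1.unique (h2.congr_of_eventuallyEq hd1)

theorem netFun_wP_add {d K : ℕ} (θ G : Params d K) (k : Fin K) (j : Fin d) (s : ℝ) :
    wP (θ + s • G) k j = wP θ k j + s * wP G k j := by simp [wP]
theorem netFun_bP_add {d K : ℕ} (θ G : Params d K) (k : Fin K) (s : ℝ) :
    bP (θ + s • G) k = bP θ k + s * bP G k := by simp [bP]
theorem netFun_vP_add {d K : ℕ} (θ G : Params d K) (k : Fin K) (s : ℝ) :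
    vP (θ + s • G) k = vP θ k + s * vP G k := by simp [vP]
theorem netFun_betaP_add {d K : ℕ} (θ G : Params d K) (s : ℝ) :
    betaP (θ + s • G) = betaP θ + s * betaP G := by simp [betaP]

/-- pre-activation -/
def zP {d K : ℕ} (θ : Params d K) (x : Euc d) (k : Fin K) : ℝ :=
  (∑ j, wP θ k j * x j) - bP θ k

theorem zP_add {d K : ℕ} (θ G : Params d K) (x : Euc d) (k : Fin K) (s : ℝ) :
    zP (θ + s • G) x k = zP θ x k + s * zP G x k := by
  simp only [zP, netFun_wP_add, netFun_bP_add, add_mul, Finset.sum_add_distrib, mul_sub,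
    Finset.mul_sum, mul_assoc]
  ring

theorem netFun_eq {d K : ℕ} (θ : Params d K) (x : Euc d) :
    netFun θ x = (∑ k, vP θ k * relu (zP θ x k)) + betaP θ := rfl

theorem diff_relu_ne {z : ℝ} (hz : z ≠ 0) : DifferentiableAt ℝ (fun s : ℝ => relu (z - s)) 0 := by
  rcases lt_or_gt_of_ne hz with h | h
  · have : (fun s : ℝ => relu (z - s)) =ᶠ[nhds 0] fun _ => (0:ℝ) := by
      filter_upwards [lt_mem_nhds h] with s hs
      exact max_eq_right (by linarith)
    exact (differentiableAt_const _).congr_of_eventuallyEq this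
  · have : (fun s : ℝ => relu (z - s)) =ᶠ[nhds 0] fun s => z - s := by
      filter_upwards [gt_mem_nhds h] with s hs
      exact max_eq_left (by linarith)
    exact ((differentiableAt_const _).sub differentiableAt_id).congr_of_eventuallyEq this

theorem kink_sum {n : ℕ} (z : Fin n → ℝ) (i0 : Fin n) (h0 : z i0 = 0)
    (hd : DifferentiableAt ℝ (fun s : ℝ => ∑ i, relu (z i - s)) 0) : False := by
  have h1 : DifferentiableAt ℝ
      (fun s : ℝ => ∑ i ∈ Finset.univ.filter (fun i => z i ≠ 0), relu (z i - s)) 0 :=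
    DifferentiableAt.fun_sum fun i hi => diff_relu_ne (Finset.mem_filter.mp hi).2
  have h2 := hd.sub h1
  set m : ℝ := ((Finset.univ.filter (fun i => ¬ z i ≠ 0)).card : ℝ) with hm
  have hmpos : 0 < m := by
    rw [hm]; exact_mod_cast Finset.card_pos.mpr ⟨i0, by simp [h0]⟩
  have h3 : DifferentiableAt ℝ (fun s : ℝ => m * relu (-s)) 0 := by
    refine h2.congr_of_eventuallyEq (Eventually.of_forall fun s => ?_)
    simp only [Pi.sub_apply]
    rw [← Finset.sum_filter_add_sum_filter_not Finset.univ (fun i => z i ≠ 0)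
      (fun i => relu (z i - s)), add_sub_cancel_left, hm, ← nsmul_eq_mul, ← Finset.sum_const]
    refine Finset.sum_congr rfl fun i hi => ?_
    have := (Finset.mem_filter.mp hi).2
    push Not at this
    rw [this, zero_sub]
  have h4 := ((h3.const_mul (2 / m)).add (differentiableAt_id (𝕜 := ℝ) (x := (0:ℝ))))
  refine not_differentiableAt_abs_zero (h4.congr_of_eventuallyEq (Eventually.of_forall fun s => ?_))
  simp only [Pi.add_apply, id, relu]
  have : 2 / m * (m * max (-s) 0) = 2 * max (-s) 0 := by field_simp
  rw [this]
  rcases le_total s 0 with h | h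
  · rw [abs_of_nonpos h, max_eq_left (by linarith)]; ring
  · rw [abs_of_nonneg h, max_eq_right (by linarith)]; ring

theorem kink_zero {d K n : ℕ} (hn : 0 < n) (x : Fin n → Euc d) (y : Fin n → ℝ)
    (θ : Params d K) (hdiff : ContDiffAt ℝ 2 (empLoss n x y) θ) (k : Fin K) (i0 : Fin n)
    (h0 : zP θ (x i0) k = 0) : vP θ k = 0 := by
  by_contra hv
  have hn' : (n : ℝ) ≠ 0 := by exact_mod_cast hn.ne'
  set eb : Params d K := EuclideanSpace.single (Sum.inr (Sum.inl k)) 1 with heb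
  set eβ : Params d K := EuclideanSpace.single (Sum.inr (Sum.inr (Sum.inr ()))) 1 with heβ
  have hev : ∀ᶠ p in nhds θ, DifferentiableAt ℝ (empLoss n x y) p :=
    (hdiff.eventually (by simp)).mono fun p hp => hp.differentiableAt (by simp)
  have hcont : Tendsto (fun r : ℝ => θ + r • eβ) (nhds 0) (nhds θ) := by
    have : ContinuousAt (fun r : ℝ => θ + r • eβ) 0 := by fun_prop
    simpa [ContinuousAt] using this
  obtain ⟨r, hr, hr0⟩ : ∃ r : ℝ, DifferentiableAt ℝ (empLoss n x y) (θ + r • eβ) ∧ r ≠ 0 := by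
    have h1 : ∀ᶠ r : ℝ in nhdsWithin 0 {0}ᶜ, DifferentiableAt ℝ (empLoss n x y) (θ + r • eβ) :=
      (hcont.eventually hev).filter_mono nhdsWithin_le_nhds
    have h2 : ∀ᶠ r : ℝ in nhdsWithin 0 {0}ᶜ, r ≠ 0 := eventually_mem_nhdsWithin
    exact (h1.and h2).exists
  have hd1 : DifferentiableAt ℝ (fun s : ℝ => empLoss n x y ((θ + r • eβ) + s • eb)) 0 := by
    have hl : DifferentiableAt ℝ (fun s : ℝ => (θ + r • eβ) + s • eb) 0 := by fun_prop
    refine DifferentiableAt.comp (0:ℝ) (g := empLoss n x y) ?_ hl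
    simpa using hr
  have hd2 : DifferentiableAt ℝ (fun s : ℝ => empLoss n x y (θ + s • eb)) 0 := by
    have hl : DifferentiableAt ℝ (fun s : ℝ => θ + s • eb) 0 := by fun_prop
    refine DifferentiableAt.comp (0:ℝ) (g := empLoss n x y) ?_ hl
    simpa using hev.self_of_nhds
  have hβ : ∀ (p : Params d K) (z : Euc d), netFun (p + r • eβ) z = netFun p z + r := by
    intro p z
    have e1 : ∀ k, zP eβ z k = 0 := by intro k; simp [zP, wP, bP, heβ]
    have e2 : ∀ k, vP eβ k = 0 := by intro k; simp [vP, heβ]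
    have e3 : betaP eβ = 1 := by simp [betaP, heβ]
    simp only [netFun_eq, netFun_vP_add, netFun_betaP_add, zP_add, e1, e2, e3]
    simp; ring
  have hb : ∀ (s : ℝ) (z : Euc d), netFun (θ + s • eb) z =
      vP θ k * relu (zP θ z k - s) + (netFun θ z - vP θ k * relu (zP θ z k)) := by
    intro s z
    have e1 : zP eb z k = -1 := by simp [zP, wP, bP, heb]
    have e1' : ∀ k', k' ≠ k → zP eb z k' = 0 := by
      intro k' hk; simp [zP, wP, bP, heb, hk]
    have e2 : ∀ k, vP eb k = 0 := by intro k; simp [vP, heb]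
    have e3 : betaP eb = 0 := by simp [betaP, heb]
    simp only [netFun_eq, netFun_vP_add, netFun_betaP_add, zP_add, e2, e3]
    rw [← Finset.add_sum_erase _ _ (Finset.mem_univ k),
      ← Finset.add_sum_erase _ (fun k => vP θ k * relu (zP θ z k)) (Finset.mem_univ k), e1]
    have : ∑ k' ∈ Finset.univ.erase k, (vP θ k' + s * 0) * relu (zP θ z k' + s * zP eb z k')
        = ∑ k' ∈ Finset.univ.erase k, vP θ k' * relu (zP θ z k') := by
      refine Finset.sum_congr rfl fun k' hk => ?_
      rw [e1' k' (Finset.ne_of_mem_erase hk)]; simp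
    rw [this]
    have : zP θ z k + s * -1 = zP θ z k - s := by ring
    rw [this]; ring
  set C : ℝ := ∑ i, (netFun θ (x i) - vP θ k * relu (zP θ (x i) k) - y i) with hC
  have hd3 := ((hd1.sub hd2).sub (differentiableAt_const (𝕜 := ℝ) (x := (0:ℝ))
    (r ^ 2 / 2))).const_mul (n / r)
  have hd4 := (hd3.sub (differentiableAt_const (𝕜 := ℝ) (x := (0:ℝ)) C)).const_mul (1 / vP θ k)
  refine kink_sum (fun i => zP θ (x i) k) i0 h0
    (hd4.congr_of_eventuallyEq (Eventually.of_forall fun s => ?_))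
  simp only [Pi.sub_apply, empLoss]
  have e : ∀ i, netFun (θ + r • eβ + s • eb) (x i) = netFun (θ + s • eb) (x i) + r := by
    intro i; rw [add_right_comm]; exact hβ _ _
  simp only [e]
  have key : ∑ i, (y i - (netFun (θ + s • eb) (x i) + r)) ^ 2
      = ∑ i, (y i - netFun (θ + s • eb) (x i)) ^ 2
        + 2 * r * (vP θ k * ∑ i, relu (zP θ (x i) k - s) + C) + n * r ^ 2 := by
    have : (n : ℝ) * r ^ 2 = ∑ i : Fin n, r ^ 2 := by simp
    rw [this, hC, Finset.mul_sum, ← Finset.sum_add_distrib, Finset.mul_sum,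
      ← Finset.sum_add_distrib, ← Finset.sum_add_distrib]
    refine Finset.sum_congr rfl fun i _ => ?_
    rw [hb s (x i)]; ring
  rw [key]
  field_simp
  ring
/-- active-neuron indicator -/
def actP {d K : ℕ} (θ : Params d K) (x : Euc d) (k : Fin K) : ℝ :=
  if 0 < zP θ x k then 1 else 0

/-- mean gradient of the network at the data -/
def gradP {d K : ℕ} (n : ℕ) (x : Fin n → Euc d) (θ : Params d K) : Params d K :=
  WithLp.toLp 2 (Sum.elim (fun kj => vP θ kj.1 * ((n : ℝ)⁻¹ * ∑ i, actP θ (x i) kj.1 * x i kj.2))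
    (Sum.elim (fun k => - (vP θ k * ((n : ℝ)⁻¹ * ∑ i, actP θ (x i) k)))
      (Sum.elim (fun k => (n : ℝ)⁻¹ * ∑ i, actP θ (x i) k * zP θ (x i) k) (fun _ => 1))))

section
variable {d K n : ℕ} (x : Fin n → Euc d) (θ : Params d K)

theorem wP_grad (k : Fin K) (j : Fin d) : wP (gradP n x θ) k j =
    vP θ k * ((n : ℝ)⁻¹ * ∑ i, actP θ (x i) k * x i j) := rfl
theorem bP_grad (k : Fin K) : bP (gradP n x θ) k =
    - (vP θ k * ((n : ℝ)⁻¹ * ∑ i, actP θ (x i) k)) := rfl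
theorem vP_grad (k : Fin K) : vP (gradP n x θ) k =
    (n : ℝ)⁻¹ * ∑ i, actP θ (x i) k * zP θ (x i) k := rfl
theorem betaP_grad : betaP (gradP n x θ) = 1 := rfl

theorem norm_sq_params (G : Params d K) : ‖G‖ ^ 2 =
    (∑ k, ((∑ j, wP G k j ^ 2) + bP G k ^ 2 + vP G k ^ 2)) + betaP G ^ 2 := by
  rw [EuclideanSpace.norm_sq_eq]
  simp only [Fintype.sum_sum_type, Fintype.sum_prod_type, Real.norm_eq_abs, sq_abs,
    Finset.sum_add_distrib, wP, bP, vP, betaP]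
  simp; ring

/-- directional derivative -/
def dirP (i : Fin n) : ℝ :=
  (∑ k, (vP θ k * (actP θ (x i) k * zP (gradP n x θ) (x i) k)
    + vP (gradP n x θ) k * (actP θ (x i) k * zP θ (x i) k))) + 1

def quadP (i : Fin n) : ℝ :=
  ∑ k, vP (gradP n x θ) k * (actP θ (x i) k * zP (gradP n x θ) (x i) k)

theorem mean_dirP (hn : 0 < n) : (n : ℝ)⁻¹ * ∑ i, dirP x θ i = ‖gradP n x θ‖ ^ 2 := by
  have hn' : (n : ℝ) ≠ 0 := by exact_mod_cast hn.ne'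
  rw [norm_sq_params, betaP_grad]
  unfold dirP
  rw [Finset.sum_add_distrib, mul_add, Finset.sum_comm, Finset.mul_sum]
  congr 1
  · refine Finset.sum_congr rfl fun k _ => ?_
    rw [Finset.sum_add_distrib, mul_add, ← Finset.mul_sum, ← Finset.mul_sum]
    congr 1
    · have : ∑ i, actP θ (x i) k * zP (gradP n x θ) (x i) k
          = (∑ j, wP (gradP n x θ) k j * ∑ i, actP θ (x i) k * x i j)
            - bP (gradP n x θ) k * ∑ i, actP θ (x i) k := by
        simp only [zP, mul_sub, Finset.sum_sub_distrib, Finset.mul_sum]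
        rw [Finset.sum_comm]
        congr 1
        · refine Finset.sum_congr rfl fun j _ => Finset.sum_congr rfl fun i _ => by ring
        · refine Finset.sum_congr rfl fun i _ => by ring
      rw [this, mul_sub, mul_sub, sub_eq_add_neg, Finset.mul_sum, Finset.mul_sum]
      congr 1
      · refine Finset.sum_congr rfl fun j _ => ?_
        rw [sq]; nth_rw 3 [wP_grad]; ring
      · rw [sq]; nth_rw 2 [bP_grad]; rw [bP_grad]; ring
    · rw [sq]; nth_rw 2 [vP_grad]; rw [vP_grad]; ring
  · simp [hn']

theorem relu_eventually (z l : ℝ) (h : z = 0 → l = 0) :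
    ∀ᶠ s : ℝ in nhds 0, relu (z + s * l) = (if 0 < z then 1 else 0) * (z + s * l) := by
  have hc : Tendsto (fun s : ℝ => z + s * l) (nhds 0) (nhds z) := by
    have : ContinuousAt (fun s : ℝ => z + s * l) 0 := by fun_prop
    simpa [ContinuousAt] using this
  rcases lt_trichotomy z 0 with hz | hz | hz
  · filter_upwards [hc.eventually (gt_mem_nhds hz)] with s hs
    rw [if_neg (by linarith), zero_mul]; exact max_eq_right hs.le
  · refine Eventually.of_forall fun s => ?_
    simp [hz, h hz, relu]
  · filter_upwards [hc.eventually (lt_mem_nhds hz)] with s hs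
    rw [if_pos hz, one_mul]; exact max_eq_left hs.le

theorem zP_grad_zero (z : Euc d) (k : Fin K) (h : vP θ k = 0) : zP (gradP n x θ) z k = 0 := by
  simp [zP, wP_grad, bP_grad, h]

theorem net_line (hk : ∀ k i, zP θ (x i) k = 0 → vP θ k = 0) (i : Fin n) :
    ∀ᶠ s : ℝ in nhds 0, netFun (θ + s • gradP n x θ) (x i) =
      netFun θ (x i) + s * dirP x θ i + s ^ 2 * quadP x θ i := by
  have h : ∀ k, ∀ᶠ s : ℝ in nhds 0, relu (zP θ (x i) k + s * zP (gradP n x θ) (x i) k)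
      = actP θ (x i) k * (zP θ (x i) k + s * zP (gradP n x θ) (x i) k) := fun k =>
    relu_eventually _ _ fun h => zP_grad_zero x θ _ k (hk k i h)
  filter_upwards [eventually_all.mpr h] with s hs
  have hs0 : ∀ k, relu (zP θ (x i) k) = actP θ (x i) k * zP θ (x i) k := by
    intro k; unfold relu actP
    split_ifs with h
    · rw [one_mul, max_eq_left h.le]
    · rw [zero_mul, max_eq_right (not_lt.mp h)]
  simp only [netFun_eq, netFun_vP_add, netFun_betaP_add, zP_add, hs, hs0, betaP_grad, dirP, quadP]
  rw [mul_add, Finset.mul_sum, Finset.mul_sum]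
  have : ∀ a b c e f : ℝ, a + b + (c + e) + f = (a + c + f) + (b + e) := by intros; ring
  rw [this, ← Finset.sum_add_distrib, ← Finset.sum_add_distrib]
  congr 1
  refine Finset.sum_congr rfl fun k _ => by ring

theorem hess_eq (y : Fin n → ℝ) (hdiff : ContDiffAt ℝ 2 (empLoss n x y) θ)
    (hk : ∀ k i, zP θ (x i) k = 0 → vP θ k = 0) :
    hessQF (empLoss n x y) θ (gradP n x θ) =
      (n : ℝ)⁻¹ * ∑ i, (dirP x θ i ^ 2 + 2 * ((netFun θ (x i) - y i) * quadP x θ i)) := by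
  set c := (1 / (2 * (n : ℝ)))
  rw [hessQF_line (empLoss n x y) θ (gradP n x θ) hdiff
    (c * ∑ i, (y i - netFun θ (x i)) ^ 2)
    (c * ∑ i, 2 * ((netFun θ (x i) - y i) * dirP x θ i))
    (c * ∑ i, (dirP x θ i ^ 2 + 2 * ((netFun θ (x i) - y i) * quadP x θ i)))
    (c * ∑ i, 2 * (dirP x θ i * quadP x θ i)) (c * ∑ i, quadP x θ i ^ 2)]
  · simp only [c]; rw [← mul_assoc]; congr 1; rw [one_div, mul_inv]; ring
  · filter_upwards [eventually_all.mpr (net_line x θ hk)] with s hs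
    simp only [empLoss, hs]
    rw [mul_assoc c _ s, mul_assoc c _ (s ^ 2), mul_assoc c _ (s ^ 3), mul_assoc c _ (s ^ 4),
      ← mul_add, ← mul_add, ← mul_add, ← mul_add]
    congr 1
    simp only [Finset.sum_mul]
    rw [← Finset.sum_add_distrib, ← Finset.sum_add_distrib, ← Finset.sum_add_distrib,
      ← Finset.sum_add_distrib]
    refine Finset.sum_congr rfl fun i _ => by ring

theorem abs_zP_le (G : Params d K) (R : ℝ) (z : Euc d) (hz : ‖z‖ ≤ R) (k : Fin K) :
    |zP G z k| ≤ √(∑ j, wP G k j ^ 2) * R + |bP G k| := by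
  have h1 : |∑ j, wP G k j * z j| ≤ √(∑ j, wP G k j ^ 2) * ‖z‖ := by
    have := abs_real_inner_le_norm z (WithLp.toLp 2 (wP G k) : Euc d)
    rw [PiLp.inner_apply] at this
    simp only [RCLike.inner_apply, conj_trivial] at this
    rw [mul_comm]
    refine this.trans (le_of_eq ?_)
    congr 1
    rw [EuclideanSpace.norm_eq]
    simp
  unfold zP
  refine (abs_sub _ _).trans ?_
  gcongr
  exact h1.trans (by gcongr)

theorem abs_quadP_le (R : ℝ) (hR : 0 < R) (hx : ∀ i, ‖x i‖ ≤ R) (i : Fin n) :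
    |quadP x θ i| ≤ (R + 1) / 2 * ‖gradP n x θ‖ ^ 2 := by
  rw [norm_sq_params]
  set G := gradP n x θ with hG
  have : (R + 1) / 2 * ∑ k, ((∑ j, wP G k j ^ 2) + bP G k ^ 2 + vP G k ^ 2) ≤
      (R + 1) / 2 * ((∑ k, ((∑ j, wP G k j ^ 2) + bP G k ^ 2 + vP G k ^ 2)) + betaP G ^ 2) := by
    gcongr; nlinarith [sq_nonneg (betaP G)]
  refine le_trans ?_ this
  rw [Finset.mul_sum]
  refine (Finset.abs_sum_le_sum_abs _ _).trans (Finset.sum_le_sum fun k _ => ?_)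
  have h1 := abs_zP_le G R (x i) (hx i) k
  have ha : |actP θ (x i) k| ≤ 1 := by unfold actP; split_ifs <;> simp
  have hS : 0 ≤ ∑ j, wP G k j ^ 2 := Finset.sum_nonneg fun _ _ => sq_nonneg _
  have hsq := Real.sq_sqrt hS
  set W := √(∑ j, wP G k j ^ 2)
  rw [← hG, abs_mul, abs_mul]
  have h2 : |actP θ (x i) k| * |zP G (x i) k| ≤ W * R + |bP G k| :=
    (mul_le_of_le_one_left (abs_nonneg _) ha).trans h1
  refine (mul_le_mul_of_nonneg_left h2 (abs_nonneg _)).trans ?_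
  rw [← hsq, ← sq_abs (bP G k), ← sq_abs (vP G k)]
  nlinarith [mul_nonneg hR.le (sq_nonneg (W - |vP G k|)), sq_nonneg (|bP G k| - |vP G k|),
    mul_nonneg hR.le (sq_nonneg |bP G k|), sq_nonneg W]

theorem grad_bound (hn : 0 < n) (y : Fin n → ℝ) (R η : ℝ) (hR : 0 < R)
    (hx : ∀ i, ‖x i‖ ≤ R)
    (hdiff : ContDiffAt ℝ 2 (empLoss n x y) θ)
    (hstable : lambdaMax (empLoss n x y) θ ≤ 2 / η) :
    ‖gradP n x θ‖ ^ 2 ≤ 2 / η + (R + 1) * √(2 * empLoss n x y θ) := by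
  have hn' : (0 : ℝ) < n := by exact_mod_cast hn
  have hk : ∀ k i, zP θ (x i) k = 0 → vP θ k = 0 := fun k i h => kink_zero hn x y θ hdiff k i h
  have h1 := (hessQF_le (empLoss n x y) θ (gradP n x θ)).trans
    (mul_le_mul_of_nonneg_right hstable (sq_nonneg _))
  rw [hess_eq x θ y hdiff hk, Finset.sum_add_distrib, mul_add] at h1
  have hm := mean_dirP x θ hn
  have hq := abs_quadP_le x θ R hR hx
  have hG1 : 1 ≤ ‖gradP n x θ‖ ^ 2 := by
    rw [norm_sq_params, betaP_grad]
    have : 0 ≤ ∑ k, ((∑ j, wP (gradP n x θ) k j ^ 2) + bP (gradP n x θ) k ^ 2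
      + vP (gradP n x θ) k ^ 2) := by positivity
    linarith
  set N := ‖gradP n x θ‖ ^ 2 with hN
  have h2 : N ^ 2 ≤ (n : ℝ)⁻¹ * ∑ i, dirP x θ i ^ 2 := by
    have := sq_sum_le_card_mul_sum_sq (s := Finset.univ) (f := dirP x θ)
    simp only [Finset.card_univ, Fintype.card_fin] at this
    rw [← hm, mul_pow]
    calc ((n : ℝ)⁻¹) ^ 2 * (∑ i, dirP x θ i) ^ 2
        ≤ ((n : ℝ)⁻¹) ^ 2 * (n * ∑ i, dirP x θ i ^ 2) := by gcongr
      _ = _ := by field_simp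
  have h3 : (n : ℝ)⁻¹ * ∑ i, |netFun θ (x i) - y i| ≤ √(2 * empLoss n x y θ) := by
    apply Real.le_sqrt_of_sq_le
    have := sq_sum_le_card_mul_sum_sq (s := Finset.univ) (f := fun i => |netFun θ (x i) - y i|)
    simp only [Finset.card_univ, Fintype.card_fin, sq_abs] at this
    rw [mul_pow]
    calc ((n : ℝ)⁻¹) ^ 2 * (∑ i, |netFun θ (x i) - y i|) ^ 2
        ≤ ((n : ℝ)⁻¹) ^ 2 * (n * ∑ i, (netFun θ (x i) - y i) ^ 2) := by gcongr
      _ = 2 * empLoss n x y θ := by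
        unfold empLoss
        have : ∑ i, (netFun θ (x i) - y i) ^ 2 = ∑ i, (y i - netFun θ (x i)) ^ 2 :=
          Finset.sum_congr rfl fun i _ => by ring
        rw [this]
        field_simp
  have h4 : -((R + 1) * N * √(2 * empLoss n x y θ)) ≤
      (n : ℝ)⁻¹ * ∑ i, 2 * ((netFun θ (x i) - y i) * quadP x θ i) := by
    have e : ∑ i, -((R + 1) * N * |netFun θ (x i) - y i|) ≤
        ∑ i, 2 * ((netFun θ (x i) - y i) * quadP x θ i) := by
      refine Finset.sum_le_sum fun i _ => ?_
      have h5 := neg_abs_le ((netFun θ (x i) - y i) * quadP x θ i)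
      rw [abs_mul] at h5
      nlinarith [mul_le_mul_of_nonneg_left (hq i) (abs_nonneg (netFun θ (x i) - y i))]
    have e2 := mul_le_mul_of_nonneg_left e (inv_nonneg.mpr hn'.le)
    rw [Finset.sum_neg_distrib, ← Finset.mul_sum] at e2
    have e3 := mul_le_mul_of_nonneg_left h3 (show 0 ≤ (R + 1) * N by positivity)
    linarith
  have h6 : N * N ≤ (2 / η + (R + 1) * √(2 * empLoss n x y θ)) * N := by nlinarith
  exact le_of_mul_le_mul_right h6 (by linarith)

end
section
variable {d K n : ℕ} (x : Fin n → Euc d) (θ : Params d K)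

/-- weight vector -/
def wvec (k : Fin K) : Euc d := WithLp.toLp 2 (wP θ k)

/-- normalized neuron -/
def pt (k : Fin K) : Euc d × ℝ := (‖wvec θ k‖⁻¹ • wvec θ k, ‖wvec θ k‖⁻¹ * bP θ k)

theorem pt_pre (k : Fin K) (z : Euc d) :
    (∑ j, (pt θ k).1 j * z j) - (pt θ k).2 = ‖wvec θ k‖⁻¹ * zP θ z k := by
  simp only [pt, wvec, zP, mul_sub, Finset.mul_sum]
  simp [mul_assoc]

theorem gTilde_nonneg (u : Euc d) (t : ℝ) : 0 ≤ gTilde n x u t := by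
  unfold gTilde
  have : 0 ≤ ∑ i ∈ Finset.univ.filter fun i => t < ∑ j, u j * x i j, ((∑ j, u j * x i j) - t) :=
    Finset.sum_nonneg fun i hi => sub_nonneg.mpr (Finset.mem_filter.mp hi).2.le
  positivity

theorem sum_act (k : Fin K) {M : Type*} [AddCommMonoid M] [Module ℝ M] (h : Fin n → M) :
    ∑ i, actP θ (x i) k • h i = ∑ i ∈ Finset.univ.filter (fun i => 0 < zP θ (x i) k), h i := by
  rw [Finset.sum_filter]
  refine Finset.sum_congr rfl fun i _ => ?_
  unfold actP; split_ifs <;> simp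

theorem neuron_bound (hn : 0 < n) (k : Fin K) (hw : wvec θ k ≠ 0) :
    2 * (|vP θ k| * ‖wvec θ k‖ * gTilde n x (pt θ k).1 (pt θ k).2) ≤
      (∑ j, wP (gradP n x θ) k j ^ 2) + bP (gradP n x θ) k ^ 2 + vP (gradP n x θ) k ^ 2 := by
  have hn' : (0 : ℝ) < n := by exact_mod_cast hn
  have hW : 0 < ‖wvec θ k‖ := norm_pos_iff.mpr hw
  set W := ‖wvec θ k‖ with hWdef
  have hfilt : (Finset.univ.filter fun i => (pt θ k).2 < ∑ j, (pt θ k).1 j * x i j) =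
      Finset.univ.filter (fun i => 0 < zP θ (x i) k) := by
    refine Finset.filter_congr fun i _ => ?_
    rw [← sub_pos, pt_pre, mul_pos_iff_of_pos_left (inv_pos.mpr hW)]
  unfold gTilde
  simp only [pt_pre, hfilt, ← hWdef]
  set A := Finset.univ.filter (fun i => 0 < zP θ (x i) k) with hA
  rw [← Finset.mul_sum]
  set m : ℝ := (A.card : ℝ) with hm
  set T : ℝ := ∑ i ∈ A, zP θ (x i) k with hT
  set X : Euc d := ∑ i ∈ A, x i with hX
  have hvg : vP (gradP n x θ) k = (n : ℝ)⁻¹ * T := by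
    rw [vP_grad, hT, ← sum_act x θ k]; rfl
  have hbg : bP (gradP n x θ) k = -(vP θ k * ((n : ℝ)⁻¹ * m)) := by
    have : m = ∑ i, actP θ (x i) k := by
      have := sum_act x θ k (fun _ => (1:ℝ))
      simp only [smul_eq_mul, mul_one] at this
      rw [this, hm]; simp [hA]
    rw [bP_grad, this]
  have hwg : ∑ j, wP (gradP n x θ) k j ^ 2 = (vP θ k * (n : ℝ)⁻¹) ^ 2 * ‖X‖ ^ 2 := by
    rw [EuclideanSpace.norm_sq_eq, Finset.mul_sum]
    refine Finset.sum_congr rfl fun j _ => ?_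
    have : X j = ∑ i, actP θ (x i) k * x i j := by
      have := sum_act x θ k (fun i => x i j)
      simp only [smul_eq_mul] at this
      rw [this, hX]; simp
      rfl
    rw [wP_grad, ← this, Real.norm_eq_abs, sq_abs]; ring
  rw [hvg, hbg, hwg]
  by_cases hm0 : m = 0
  · rw [hm0]; simp; positivity
  have hmp : 0 < m := lt_of_le_of_ne (by rw [hm]; positivity) (Ne.symm hm0)
  have hsq : m * √(1 + ‖m⁻¹ • X‖ ^ 2) = √(m ^ 2 + ‖X‖ ^ 2) := by
    rw [← Real.sqrt_sq hmp.le, ← Real.sqrt_mul (sq_nonneg _), Real.sqrt_sq hmp.le, norm_smul,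
      mul_pow, norm_inv, Real.norm_eq_abs, abs_of_pos hmp]
    congr 1; field_simp
  have e : |vP θ k| * W * ((m / n) ^ 2 * (W⁻¹ * T / m) * √(1 + ‖m⁻¹ • X‖ ^ 2)) =
      ((n : ℝ)⁻¹ * T) * (|vP θ k| * (n : ℝ)⁻¹ * √(m ^ 2 + ‖X‖ ^ 2)) := by
    rw [← hsq]; field_simp
  rw [e]
  have h2 := Real.sq_sqrt (show 0 ≤ m ^ 2 + ‖X‖ ^ 2 by positivity)
  have h3 : (|vP θ k| * (n : ℝ)⁻¹ * √(m ^ 2 + ‖X‖ ^ 2)) ^ 2 =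
     (vP θ k * (n : ℝ)⁻¹) ^ 2 * ‖X‖ ^ 2 + (-(vP θ k * ((n : ℝ)⁻¹ * m))) ^ 2 := by
    rw [mul_pow, h2, mul_pow, sq_abs]; ring
  rw [← h3]
  nlinarith [sq_nonneg ((n : ℝ)⁻¹ * T - |vP θ k| * (n : ℝ)⁻¹ * √(m ^ 2 + ‖X‖ ^ 2))]

theorem affine_out (R : ℝ) (hR : 0 < R) (k : Fin K)
    (hk : ¬ (wvec θ k ≠ 0 ∧ (pt θ k).2 ∈ Set.Icc (-R) R)) :
    ∃ (c : Euc d) (c₀ : ℝ), ∀ z ∈ Metric.closedBall (0 : Euc d) R,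
      vP θ k * relu (zP θ z k) = (∑ j, c j * z j) + c₀ := by
  have hin : ∀ z : Euc d, ∑ j, wP θ k j * z j = inner ℝ z (wvec θ k) := by
    intro z; simp [PiLp.inner_apply, wvec]
  by_cases hw : wvec θ k = 0
  · refine ⟨0, vP θ k * relu (- bP θ k), fun z _ => ?_⟩
    rw [zP, hin, hw]; simp
  have hW : 0 < ‖wvec θ k‖ := norm_pos_iff.mpr hw
  have hb : ∀ z ∈ Metric.closedBall (0 : Euc d) R, |∑ j, wP θ k j * z j| ≤ R * ‖wvec θ k‖ := by
    intro z hz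
    rw [hin]
    refine (abs_real_inner_le_norm _ _).trans ?_
    gcongr
    simpa using hz
  have h2 : ¬ (pt θ k).2 ∈ Set.Icc (-R) R := fun h => hk ⟨hw, h⟩
  have hbt : bP θ k = (pt θ k).2 * ‖wvec θ k‖ := by simp only [pt]; field_simp
  rw [Set.mem_Icc, not_and_or, not_le, not_le] at h2
  rcases h2 with h2 | h2
  · refine ⟨vP θ k • wvec θ k, - (vP θ k * bP θ k), fun z hz => ?_⟩
    have h3 := (abs_le.mp (hb z hz)).1
    have : relu (zP θ z k) = zP θ z k := max_eq_left (by rw [zP, hbt]; nlinarith)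
    rw [this, zP, mul_sub, Finset.mul_sum, sub_eq_add_neg]
    simp [wvec, mul_assoc]
  · refine ⟨0, 0, fun z hz => ?_⟩
    have h3 := (abs_le.mp (hb z hz)).2
    have : relu (zP θ z k) = 0 := max_eq_right (by rw [zP, hbt]; nlinarith)
    rw [this]; simp

end

theorem exists_atomic {P : Type*} [MeasurableSpace P] [MeasurableSingletonClass P]
    {ι : Type*} (κ : Finset ι) (p : ι → P) (a : ι → ℝ) :
    ∃ ν : MeasureTheory.SignedMeasure P,
      (∀ S : Set P, MeasurableSet S → (∀ k ∈ κ, p k ∉ S) → ν.totalVariation S = 0) ∧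
      (∀ h : P → ℝ, (∫ q, h q ∂ν.toJordanDecomposition.posPart)
        - (∫ q, h q ∂ν.toJordanDecomposition.negPart) = ∑ k ∈ κ, a k * h (p k)) ∧
      (∀ g : P → ℝ, (∀ q, 0 ≤ g q) → ∫⁻ q, ENNReal.ofReal (g q) ∂ν.totalVariation ≤
        ENNReal.ofReal (∑ k ∈ κ, |a k| * g (p k))) := by
  set T : Finset P := κ.image p with hT
  set A : P → ℝ := fun q => ∑ k ∈ κ with p k = q, a k with hA
  set μ : (P → ℝ) → Measure P := fun B => ∑ q ∈ T, ENNReal.ofReal (B q) • Measure.dirac q with hμ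
  have hfin : ∀ B, IsFiniteMeasure (μ B) := by
    intro B
    refine ⟨?_⟩
    simp only [hμ, Measure.coe_finset_sum, Finset.sum_apply, Measure.smul_apply, smul_eq_mul]
    exact ENNReal.sum_lt_top.mpr fun q _ => by simp
  have hzero : ∀ (B : P → ℝ) (S : Set P), MeasurableSet S → (∀ q ∈ T, q ∈ S → B q ≤ 0) →
      μ B S = 0 := by
    intro B S hS h
    simp only [hμ, Measure.coe_finset_sum, Finset.sum_apply, Measure.smul_apply, smul_eq_mul]
    refine Finset.sum_eq_zero fun q hq => ?_
    by_cases hqS : q ∈ S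
    · rw [ENNReal.ofReal_of_nonpos (h q hq hqS), zero_mul]
    · rw [Measure.dirac_apply' _ hS]; simp [hqS]
  have hmeas : MeasurableSet ((T.filter (fun q => A q ≤ 0) : Finset P) : Set P) :=
    Finset.measurableSet _
  have hms : μ A ⟂ₘ μ (fun q => - A q) := by
    refine ⟨((T.filter (fun q => A q ≤ 0) : Finset P) : Set P), hmeas, ?_, ?_⟩
    · refine hzero _ _ hmeas fun q _ hq => ?_
      exact (Finset.mem_filter.mp (Finset.mem_coe.mp hq)).2
    · refine hzero _ _ hmeas.compl fun q hqT hq => ?_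
      by_contra hneg
      exact hq (Finset.mem_coe.mpr (Finset.mem_filter.mpr ⟨hqT, by linarith⟩))
  let j : JordanDecomposition P :=
    { posPart := μ A, negPart := μ (fun q => - A q), posPart_finite := hfin _,
      negPart_finite := hfin _, mutuallySingular := hms }
  have hj : j.toSignedMeasure.toJordanDecomposition = j :=
    SignedMeasure.toJordanDecomposition_eq rfl
  have hint : ∀ (B : P → ℝ) (h : P → ℝ), ∫ q, h q ∂(μ B) = ∑ q ∈ T, max (B q) 0 * h q := by
    intro B h
    simp only [hμ]
    rw [integral_finsetSum_measure]
    · refine Finset.sum_congr rfl fun q _ => ?_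
      rw [integral_smul_measure, integral_dirac, ENNReal.toReal_ofReal', smul_eq_mul]
    · intro q _
      exact (integrable_dirac (by simp)).smul_measure (by simp)
  have hfib : ∀ h : P → ℝ, ∀ b : ι → ℝ,
      ∑ q ∈ T, (∑ k ∈ κ with p k = q, b k) * h q = ∑ k ∈ κ, b k * h (p k) := by
    intro h b
    rw [← Finset.sum_fiberwise_of_maps_to (t := T) (g := p)
      (fun k hk => Finset.mem_image_of_mem p hk)]
    refine Finset.sum_congr rfl fun q _ => ?_
    rw [Finset.sum_mul]
    refine Finset.sum_congr rfl fun k hk => ?_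
    rw [(Finset.mem_filter.mp hk).2]
  refine ⟨j.toSignedMeasure, ?_, ?_, ?_⟩
  · intro S hS h
    have h' : ∀ q ∈ T, q ∉ S := by
      intro q hq
      obtain ⟨k, hk, rfl⟩ := Finset.mem_image.mp hq
      exact h k hk
    rw [SignedMeasure.totalVariation, hj, Measure.add_apply,
      hzero _ S hS fun q hq hq' => absurd hq' (h' q hq),
      hzero _ S hS fun q hq hq' => absurd hq' (h' q hq), add_zero]
  · intro h
    rw [hj]
    change (∫ q, h q ∂(μ A)) - (∫ q, h q ∂(μ fun q => - A q)) = _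
    rw [hint, hint, ← Finset.sum_sub_distrib, ← hfib]
    refine Finset.sum_congr rfl fun q _ => ?_
    rw [← sub_mul]
    congr 1
    change max (A q) 0 - max (- A q) 0 = A q
    rcases le_total (A q) 0 with h | h
    · rw [max_eq_right h, max_eq_left (by linarith)]; ring
    · rw [max_eq_left h, max_eq_right (by linarith)]; ring
  · intro g hg
    rw [SignedMeasure.totalVariation, hj]
    change ∫⁻ q, ENNReal.ofReal (g q) ∂(μ A + μ fun q => - A q) ≤ _
    rw [lintegral_add_measure]
    have hl : ∀ B : P → ℝ, ∫⁻ q, ENNReal.ofReal (g q) ∂(μ B) =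
        ENNReal.ofReal (∑ q ∈ T, max (B q) 0 * g q) := by
      intro B
      simp only [hμ]
      rw [lintegral_finsetSum_measure, ENNReal.ofReal_sum_of_nonneg]
      · refine Finset.sum_congr rfl fun q _ => ?_
        rw [lintegral_smul_measure, lintegral_dirac, smul_eq_mul,
          ENNReal.ofReal_mul (le_max_right _ _)]
        congr 1
        rcases le_total (B q) 0 with h | h
        · rw [max_eq_right h, ENNReal.ofReal_of_nonpos h]; simp
        · rw [max_eq_left h]
      · intro q _
        exact mul_nonneg (le_max_right _ _) (hg q)
    rw [hl, hl, ← ENNReal.ofReal_add]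
    · apply ENNReal.ofReal_le_ofReal
      rw [← Finset.sum_add_distrib, ← hfib]
      refine Finset.sum_le_sum fun q _ => ?_
      rw [← add_mul]
      refine mul_le_mul_of_nonneg_right ?_ (hg q)
      refine le_trans (le_of_eq ?_) (Finset.abs_sum_le_sum_abs _ _)
      change max (A q) 0 + max (- A q) 0 = |A q|
      rcases le_total (A q) 0 with h | h
      · rw [max_eq_right h, max_eq_left (by linarith), abs_of_nonpos h]; ring
      · rw [max_eq_left h, max_eq_right (by linarith), abs_of_nonneg h]; ring
    · exact Finset.sum_nonneg fun q _ => mul_nonneg (le_max_right _ _) (hg q)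
    · exact Finset.sum_nonneg fun q _ => mul_nonneg (le_max_right _ _) (hg q)

/-- **Weighted variation bound for stable minima (Corollary `cor:regularity`).** -/
theorem stable_minima_variation_bound
    (d K n : ℕ) (R η : ℝ) (hR : 0 < R) (hη : 0 < η) (hn : 0 < n)
    (x : Fin n → Euc d) (y : Fin n → ℝ)
    (hx : ∀ i, x i ∈ Metric.closedBall (0 : Euc d) R)
    (θ : Params d K) (hdiff : ContDiffAt ℝ 2 (empLoss n x y) θ)
    (hstable : lambdaMax (empLoss n x y) θ ≤ 2 / η) :
    VgSeminorm d R (gData n x) (fun z => netFun θ z) ≤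
      ENNReal.ofReal (1 / η - 1 / 2 + (R + 1) * Real.sqrt (2 * empLoss n x y θ)) := by
  have hx' : ∀ i, ‖x i‖ ≤ R := fun i => by simpa using hx i
  have hG := grad_bound x θ hn y R η hR hx' hdiff hstable
  set κ : Finset (Fin K) :=
    Finset.univ.filter (fun k => wvec θ k ≠ 0 ∧ (pt θ k).2 ∈ Set.Icc (-R) R) with hκ
  obtain ⟨ν, hν1, hν2, hν3⟩ := exists_atomic κ (pt θ) (fun k => vP θ k * ‖wvec θ k‖)
  have hout : ∀ k, ∃ (c : Euc d) (c₀ : ℝ), k ∉ κ → ∀ z ∈ Metric.closedBall (0 : Euc d) R,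
      vP θ k * relu (zP θ z k) = (∑ j, c j * z j) + c₀ := by
    intro k
    by_cases hk : k ∈ κ
    · exact ⟨0, 0, fun h => absurd hk h⟩
    · obtain ⟨c, c₀, h⟩ := affine_out θ R hR k (by simpa [hκ] using hk)
      exact ⟨c, c₀, fun _ => h⟩
  choose c c₀ hc using hout
  have hg0 : ∀ q, 0 ≤ gData n x q := fun q => le_min (gTilde_nonneg x _ _) (gTilde_nonneg x _ _)
  have hmem : VgSeminorm d R (gData n x) (fun z => netFun θ z) ≤
      ∫⁻ p, ENNReal.ofReal (gData n x p) ∂ν.totalVariation := by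
    refine sInf_le ⟨ν, ∑ k ∈ κᶜ, c k, (∑ k ∈ κᶜ, c₀ k) + betaP θ, ?_, ?_, rfl⟩
    · refine hν1 _ ((Metric.isClosed_sphere.measurableSet).prod measurableSet_Icc).compl ?_
      intro k hk hmem
      obtain ⟨hw, ht⟩ := (Finset.mem_filter.mp hk).2
      refine hmem ⟨?_, ht⟩
      have hW : 0 < ‖wvec θ k‖ := norm_pos_iff.mpr hw
      simp only [pt, mem_sphere_zero_iff_norm, norm_smul, norm_inv, norm_norm]
      field_simp
    · intro z hz
      rw [hν2 (fun p => relu ((∑ j, p.1 j * z j) - p.2))]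
      change netFun θ z = _
      rw [netFun_eq, ← Finset.sum_add_sum_compl κ]
      have e1 : ∑ k ∈ κ, vP θ k * relu (zP θ z k) = ∑ k ∈ κ, vP θ k * ‖wvec θ k‖ *
          relu ((∑ j, (pt θ k).1 j * z j) - (pt θ k).2) := by
        refine Finset.sum_congr rfl fun k hk => ?_
        obtain ⟨hw, ht⟩ := (Finset.mem_filter.mp hk).2
        have hW : 0 < ‖wvec θ k‖ := norm_pos_iff.mpr hw
        rw [pt_pre, mul_assoc]
        congr 1
        unfold relu
        rw [mul_max_of_nonneg _ _ hW.le, mul_zero, mul_inv_cancel_left₀ hW.ne']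
      have e2 : ∑ k ∈ κᶜ, vP θ k * relu (zP θ z k) =
          (∑ j, (∑ k ∈ κᶜ, c k) j * z j) + ∑ k ∈ κᶜ, c₀ k := by
        rw [Finset.sum_congr rfl fun k hk => hc k (Finset.mem_compl.mp hk) z hz,
          Finset.sum_add_distrib, Finset.sum_comm]
        congr 1
        refine Finset.sum_congr rfl fun j _ => ?_
        rw [← Finset.sum_mul]
        simp
      rw [e1, e2]; ring
  refine hmem.trans ((hν3 _ hg0).trans (ENNReal.ofReal_le_ofReal ?_))
  have hS : 2 * ∑ k ∈ κ, |vP θ k * ‖wvec θ k‖| * gData n x (pt θ k) + 1 ≤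
      ‖gradP n x θ‖ ^ 2 := by
    rw [norm_sq_params, betaP_grad, one_pow]
    gcongr ?_ + 1
    rw [Finset.mul_sum]
    refine le_trans (Finset.sum_le_sum fun k hk => ?_)
      (Finset.sum_le_sum_of_subset_of_nonneg (Finset.subset_univ κ) fun k _ _ => by positivity)
    refine le_trans ?_ (neuron_bound x θ hn k (Finset.mem_filter.mp hk).2.1)
    rw [abs_mul, abs_norm]
    gcongr
    exact min_le_left _ _
  have hs0 : 0 ≤ (R + 1) * √(2 * empLoss n x y θ) := by positivity
  have : 2 / η = 2 * (1 / η) := by ring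
  rw [this] at hG
  linarith

end
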